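/- For every r ∈ (0,1), K(r) > (π[16 − 5 log(1 − r²)] + 2δ(1 − r) r²)/(32 + 2(5π − 16)r²) − λ r², where λ = 8/5 − log 4 and δ = 128/5 − 32 log 2 − 17π/2 + 5π²/2. -/

import Mathlib

open Real Set Filter Topology

/-- The complete elliptic integral of the first kind. -/
noncomputable def K (r : ℝ) : ℝ :=
  ∫ t in (0:ℝ)..(π/2), (1 - r^2 * Real.sin t ^ 2) ^ (-(1:ℝ)/2)

noncomputable def cc : ℕ → ℝ
  | 0 => 1
  | (n+1) => cc n * ((2*n+1)/(2*n+2))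

lemma cc_pos (n : ℕ) : 0 < cc n := by
  induction n with
  | zero => simp [cc]
  | succ n ih => rw [cc]; positivity

lemma cc_choose (n : ℕ) : Ring.choose (-(1:ℝ)/2) n = (-1)^n * cc n := by
  induction n with
  | zero => simp [cc]
  | succ n ih =>
    have h : Ring.choose (-(1:ℝ)/2) (n+1) = Ring.choose (-(1:ℝ)/2) n * ((-(1:ℝ)/2 - n)/(n+1)) := by
      have hd : (descPochhammer ℤ (n+1)).smeval (-(1:ℝ)/2) = (descPochhammer ℤ n).smeval (-(1:ℝ)/2) * (-(1:ℝ)/2 - n) := by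
        rw [descPochhammer_succ_right, Polynomial.smeval_mul, Polynomial.smeval_sub, Polynomial.smeval_X,
          Polynomial.smeval_natCast]
        simp
      rw [Ring.choose_eq_smul, Ring.choose_eq_smul, hd, Nat.factorial_succ]
      have : (n.factorial : ℝ) ≠ 0 := by positivity
      have h2 : (n:ℝ)+1 ≠ 0 := by positivity
      push_cast
      simp only [smul_eq_mul]
      field_simp
    rw [h, ih, cc, pow_succ]
    have h2 : (n:ℝ)+1 ≠ 0 := by positivity
    field_simp
    ring

lemma cc_series (u : ℝ) (h0 : 0 ≤ u) (h1 : u < 1) :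
    HasSum (fun n => cc n * u^n) ((1-u)^(-(1:ℝ)/2)) := by
  have h := (Real.one_add_rpow_hasFPowerSeriesOnBall_zero (a := -(1:ℝ)/2)).hasSum (y := -u)
    (by simp [enorm_eq_nnnorm]; rw [← NNReal.coe_lt_coe]; simpa [abs_of_nonneg h0] using h1)
  simp only [zero_add, binomialSeries_apply, List.ofFn_const, List.prod_replicate, smul_eq_mul] at h
  have e : ∀ n, cc n * u^n = Ring.choose (-(1:ℝ)/2) n * (-u)^n := by
    intro n
    rw [cc_choose, neg_pow u n]
    have : ((-1:ℝ)^n)*((-1)^n) = 1 := by rw [← mul_pow]; simp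
    linear_combination (-(cc n * u^n)) * this
  rw [← sub_eq_add_neg] at h
  exact (funext e : (fun n => cc n * u^n) = _) ▸ h

lemma sin_int (n : ℕ) : ∫ t in (0:ℝ)..(π/2), sin t ^ (2*n) = π/2 * cc n := by
  induction n with
  | zero => simp [cc]
  | succ n ih =>
    rw [show 2*(n+1) = 2*n+2 by ring, integral_sin_pow, ih, cc]
    push_cast
    simp
    ring

lemma cc_wallis (n : ℕ) : cc n ^ 2 * (2*n+1) * Real.Wallis.W n = 1 := by
  induction n with
  | zero => simp [cc, Real.Wallis.W]
  | succ n ih =>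
    rw [Real.Wallis.W_succ, cc]
    refine Eq.trans ?_ ih
    push_cast
    field_simp
    ring

lemma cc_bound (n : ℕ) : cc n ^ 2 * (π * (2*n+1)^2) ≤ 4*n+4 := by
  have h := Real.Wallis.le_W n
  have h2 := cc_wallis n
  have h3 := cc_pos n
  have h4 : cc n ^ 2 * (2*n+1) * (((2 : ℝ) * n + 1) / (2 * n + 2) * (π / 2)) ≤ 1 := by
    refine le_trans ?_ h2.le
    gcongr
  have h5 : cc n ^ 2 * (2*n+1) * (((2 : ℝ) * n + 1) / (2 * n + 2) * (π / 2)) = cc n ^ 2 * (π * (2*n+1)^2) / (4*n+4) := by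
    field_simp; ring
  rw [h5, div_le_one (by positivity)] at h4
  exact h4

lemma coef_neg (n : ℕ) : 16 * cc (n+1)^2 + (5*π-16) * cc n ^2 ≤ 5/(n+1) := by
  have h := cc_bound n
  have h3 := cc_pos n
  have hp := Real.pi_lt_d2
  have hp' := Real.pi_gt_three
  rw [cc, le_div_iff₀ (by positivity)]
  have e : (16 * (cc n * ((2 * ↑n + 1) / (2 * ↑n + 2))) ^ 2 + (5 * π - 16) * cc n ^ 2) * ((n:ℝ) + 1)
     = cc n ^2 * ((16 * (2*n+1)^2 + (5*π-16)*(2*n+2)^2) / (4*(n+1))) := by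
    field_simp
    ring
  rw [e, ← mul_div_assoc, div_le_iff₀ (by positivity)]
  have : (16 * (2*n+1)^2 + (5*π-16)*(2*n+2)^2 : ℝ) ≤ 5 * (π * (2*n+1)^2) := by
    have : (0:ℝ) ≤ n := by positivity
    nlinarith
  nlinarith [mul_le_mul_of_nonneg_left this (sq_nonneg (cc n))]

lemma K_series (r : ℝ) (h0 : 0 < r) (h1 : r < 1) :
    HasSum (fun n => π/2 * cc n ^2 * (r^2)^n) (K r) := by
  have hr2 : r^2 < 1 := by nlinarith
  have hs := cc_series (r^2) (by positivity) hr2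
  have key := intervalIntegral.hasSum_integral_of_dominated_convergence (μ := MeasureTheory.volume)
    (a := 0) (b := π/2)
    (F := fun n t => cc n * (r^2 * sin t^2)^n) (f := fun t => (1 - r^2 * Real.sin t ^ 2) ^ (-(1:ℝ)/2))
    (fun n _ => cc n * (r^2)^n) (fun n => (by fun_prop : Continuous _).aestronglyMeasurable)
    (fun n => .of_forall fun t _ => by
      have := cc_pos n
      rw [norm_of_nonneg (by positivity)]
      gcongr
      have := sin_sq_le_one t
      nlinarith [sq_nonneg r])
    (.of_forall fun t _ => hs.summable)
    (by simp)
    (.of_forall fun t _ => cc_series _ (by positivity) (by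
      have := sin_sq_le_one t
      nlinarith [sq_nonneg r]))
  unfold K
  have e : ∀ n, π/2 * cc n ^2 * (r^2)^n = ∫ t in (0:ℝ)..(π/2), cc n * (r^2 * sin t^2)^n := by
    intro n
    simp_rw [mul_pow, ← mul_assoc, ← pow_mul]
    rw [intervalIntegral.integral_const_mul, sin_int]
    ring
  exact (funext e : (fun n => π/2 * cc n ^2 * (r^2)^n) = _) ▸ key

lemma K_low (r : ℝ) (h0 : 0 < r) (h1 : r < 1) :
    log 2 + log (1 + r) - log (1-r^2) / 2 ≤ K r := by
  have hpp := Real.pi_pos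
  have hq : ∀ t : ℝ, 0 < 1 - r^2 * sin t^2 := fun t => by
    have := sin_sq_le_one t
    nlinarith [sq_nonneg r]
  have hcont : Continuous fun t : ℝ => (1 - r^2 * Real.sin t ^ 2) ^ (-(1:ℝ)/2) := by
    refine Continuous.rpow_const (by fun_prop) fun t => Or.inl (hq t).ne'
  have key := intervalIntegral.sub_le_integral_of_hasDeriv_right_of_le (a := 0) (b := π/2)
    (g := fun t => log (1 + sin t) - log (r * cos t + √(1 - r^2 * sin t^2)))
    (g' := fun t => cos t / (1 + sin t) + r * sin t / √(1 - r^2 * sin t^2))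
    (φ := fun t => (1 - r^2 * Real.sin t ^ 2) ^ (-(1:ℝ)/2)) (by positivity)
    (by
      intro t ht
      have hs : 0 ≤ sin t := sin_nonneg_of_mem_Icc ⟨ht.1, by linarith [ht.2]⟩
      have hc : 0 ≤ cos t := cos_nonneg_of_mem_Icc ⟨by linarith [ht.1], ht.2⟩
      have h2 := sqrt_pos.2 (hq t)
      have : r * cos t + √(1 - r^2 * sin t^2) ≠ 0 := by positivity
      have : 1 + sin t ≠ 0 := by positivity
      apply ContinuousAt.continuousWithinAt
      fun_prop (disch := assumption))
    (by
      intro t ht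
      have hs : 0 ≤ sin t := sin_nonneg_of_mem_Icc ⟨ht.1.le, by linarith [ht.2]⟩
      have hc : 0 ≤ cos t := cos_nonneg_of_mem_Icc ⟨by linarith [ht.1], ht.2.le⟩
      have h2 := sqrt_pos.2 (hq t)
      have h3 : r * cos t + √(1 - r^2 * sin t^2) ≠ 0 := by positivity
      have h4 : 1 + sin t ≠ 0 := by positivity
      apply HasDerivAt.hasDerivWithinAt
      have d1 := ((hasDerivAt_sin t).const_add 1).log h4
      have d2 := ((((hasDerivAt_sin t).pow 2).const_mul (r^2)).const_sub 1).sqrt (hq t).ne'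
      have d3 := (((hasDerivAt_cos t).const_mul r).add d2).log h3
      refine (d1.sub d3).congr_deriv ?_
      simp only [Pi.pow_apply, Pi.add_apply]
      generalize √(1 - r^2 * sin t^2) = q at *
      field_simp
      push_cast
      ring)
    (hcont.continuousOn.integrableOn_Icc)
    (by
      intro t ht
      have hs : 0 ≤ sin t := sin_nonneg_of_mem_Icc ⟨ht.1.le, by linarith [ht.2]⟩
      have hc : 0 ≤ cos t := cos_nonneg_of_mem_Icc ⟨by linarith [ht.1], ht.2.le⟩
      have h2 := sqrt_pos.2 (hq t)
      have e : (1 - r^2 * Real.sin t ^ 2) ^ (-(1:ℝ)/2) = 1 / √(1 - r^2 * sin t^2) := by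
        rw [sqrt_eq_rpow, neg_div, rpow_neg (hq t).le, one_div (_ ^ _)]
      simp only [e]
      have hs1 := sin_le_one t
      have hq2 := sq_sqrt (hq t).le
      have hsc := sin_sq_add_cos_sq t
      set q := √(1 - r^2 * sin t^2)
      have hrs : r * sin t ≤ sin t := by nlinarith
      have a1 : cos t * q ≤ (1 - r * sin t) * (1 + sin t) := by
        apply abs_le_of_sq_le_sq' _ _ |>.2
        · rw [mul_pow, hq2, show cos t ^2 = 1 - sin t^2 by linarith]
          have : 0 ≤ (1 - r * sin t) * (1 + sin t) := mul_nonneg (by linarith) (by linarith)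
          have := mul_nonneg this (show 0 ≤ (1 - r * sin t) * (1 + sin t) - (1 + r * sin t) * (1 - sin t) by nlinarith)
          nlinarith
        · exact mul_nonneg (by linarith) (by linarith)
      rw [← le_sub_iff_add_le, ← sub_div, div_le_div_iff₀ (by linarith) h2]
      exact a1)
  simp only [sin_pi_div_two, cos_pi_div_two, sin_zero, cos_zero] at key
  norm_num at key
  rw [Real.log_sqrt (by nlinarith)] at key
  rw [add_comm r 1] at key
  unfold K
  norm_num at key ⊢
  linarith

noncomputable def QQ (r : ℝ) : ℝ :=
  (32 + 2*(5*π-16)*r^2) * K r + 5*π*log (1-r^2) - 16*π - (5*π^2-17*π)*r^2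

noncomputable def hh (n : ℕ) : ℝ :=
  π * (16 * cc (n+2)^2 + (5*π-16)*cc (n+1)^2 - 5/(n+2))

lemma hh_neg (n : ℕ) : hh n ≤ 0 := by
  have := coef_neg (n+1)
  push_cast at this
  rw [add_assoc (n:ℝ) 1 1, one_add_one_eq_two] at this
  exact mul_nonpos_of_nonneg_of_nonpos Real.pi_pos.le (by linarith)

lemma QQ_series (r : ℝ) (h0 : 0 < r) (h1 : r < 1) :
    HasSum (fun n => hh n * (r^2)^(n+2)) (QQ r) := by
  have hk := K_series r h0 h1
  have hk1 := (hasSum_nat_add_iff' 1).2 hk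
  have hk2 := (hasSum_nat_add_iff' 2).2 hk
  have hl := (hasSum_nat_add_iff' 1).2 (hasSum_pow_div_log_of_abs_lt_one (x := r^2)
    (by rw [abs_of_nonneg (by positivity)]; nlinarith))
  have := ((hk2.mul_left 32).add (hk1.mul_left (2*(5*π-16)*r^2))).sub (hl.mul_left (5*π))
  have e := (this.congr_fun (g := fun n => hh n * (r^2)^(n+2)) (fun n => by
    have : (n:ℝ) + 2 ≠ 0 := by positivity
    have h3 : ((n+1:ℕ):ℝ) + 1 = n + 2 := by push_cast; ring
    simp only [h3]
    unfold hh
    field_simp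
    ring))
  refine (?_ : _ = QQ r) ▸ e
  simp only [Finset.sum_range_succ, Finset.sum_range_zero, cc]
  unfold QQ
  push_cast
  ring

lemma QQ_low (s : ℝ) (h0 : 0 < s) (h1 : s < 1) :
    10*π*(log 2 + log (1+s)) - 16*π - (5*π^2-17*π)*s^2 ≤ QQ s := by
  have h := K_low s h0 h1
  have hp := Real.pi_lt_d2
  have hp' := Real.pi_pos
  have hs2 : s^2 < 1 := by nlinarith
  have hl : log (1 - s^2) ≤ 0 := log_nonpos (by linarith) (by nlinarith)
  have hK : 0 ≤ K s := by
    have := log_nonneg (show (1:ℝ) ≤ 2 by norm_num)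
    have := log_nonneg (show (1:ℝ) ≤ 1 + s by linarith)
    linarith
  unfold QQ
  have a1 : 0 ≤ (16 - 5*π) * (1 - s^2) * K s :=
    mul_nonneg (mul_nonneg (by linarith) (by linarith)) hK
  have a2 := mul_le_mul_of_nonneg_left h (show 0 ≤ 10*π by linarith)
  nlinarith

lemma QQ_mono (r s : ℝ) (h0 : 0 < r) (hrs : r < s) (h1 : s < 1) :
    r^4 * QQ s ≤ s^4 * QQ r := by
  have hs := (QQ_series s (h0.trans hrs) h1).mul_left (r^4)
  have hr := (QQ_series r h0 (hrs.trans h1)).mul_left (s^4)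
  refine hasSum_le (fun n => ?_) hs hr
  have : r^4 * (hh n * (s^2)^(n+2)) - s^4 * (hh n * (r^2)^(n+2)) =
     hh n * (r^4*s^4*((s^2)^n - (r^2)^n)) := by ring
  have h2 : (r^2)^n ≤ (s^2)^n := by gcongr
  have := mul_nonneg (neg_nonneg.2 (hh_neg n)) (mul_nonneg (by positivity : 0 ≤ r^4*s^4) (sub_nonneg.2 h2))
  linarith

lemma QQ_final (r : ℝ) (h0 : 0 < r) (h1 : r < 1) :
    r^4 * (20*π*log 2 + π - 5*π^2) ≤ QQ r := by
  have hc : ContinuousAt (fun s : ℝ => s^4 * QQ r - r^4 * (10*π*(log 2 + log (1+s)) - 16*π - (5*π^2-17*π)*s^2)) 1 := by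
    have : (1:ℝ) + 1 ≠ 0 := by norm_num
    fun_prop (disch := assumption)
  have ht := hc.tendsto.mono_left (nhdsWithin_le_nhds (s := Iio 1))
  have := ge_of_tendsto ht (b := 0) (by
    filter_upwards [Ioo_mem_nhdsLT h1] with s hs
    have a := QQ_mono r s h0 hs.1 hs.2
    have b := mul_le_mul_of_nonneg_left (QQ_low s (h0.trans hs.1) hs.2) (show 0 ≤ r^4 by positivity)
    linarith)
  norm_num at this
  linarith

theorem K_lower_g (r : ℝ) (hr : r ∈ Ioo (0:ℝ) 1) :
    (π * (16 - 5 * Real.log (1 - r^2)) + 2 * (128/5 - 32 * Real.log 2 - 17*π/2 + 5*π^2/2) * (1 - r) * r^2) /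
        (32 + 2*(5*π - 16)*r^2) - (8/5 - Real.log 4) * r^2 < K r := by
  obtain ⟨h0, h1⟩ := hr
  have hQ := QQ_final r h0 h1
  have hp := Real.pi_gt_d2
  have hl2 := Real.log_two_lt_d9
  have l4 : log 4 = 2 * log 2 := by
    rw [show (4:ℝ) = 2^2 by norm_num, log_pow]; norm_num
  have hd : 0 < 128/5 - 32 * Real.log 2 - 17*π/2 + 5*π^2/2 := by nlinarith
  have hden : 0 < 32 + 2*(5*π - 16)*r^2 := by nlinarith [sq_nonneg r]
  rw [sub_lt_iff_lt_add, div_lt_iff₀ hden, l4]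
  unfold QQ at hQ
  have := mul_pos (mul_pos hd (pow_pos h0 3)) (sub_pos.2 h1)
  nlinarith
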